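/- arXiv:1802.03963 — 4 statements merged into one kernel-verified Lean document; each statement's English description precedes it below -/
import Mathlib

section
/- Let N ≥ 2 and let t ∈ [2, 2N/(N−1)]. Then for every smooth compactly supported function u : ℝ × ℝ^N → ℝ one has ∫_{ℝ^N} |u(0,y)|^t dy ≤ t · (∬_{ℝ^{N+1}_+} |u(x,y)|^{2(t−1)} dx dy)^{1/2} · (∬_{ℝ^{N+1}_+} |∇u(x,y)|² dx dy)^{1/2}. -/
open MeasureTheory Real Filter Set

noncomputable section

/-- The open half-space `ℝ^{N+1}_+ = (0,∞) × ℝ^N`. -/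
def halfSpace (N : ℕ) : Set (ℝ × EuclideanSpace ℝ (Fin N)) := {p | 0 < p.1}

/-- Squared Euclidean norm of the full gradient of `u : ℝ × ℝ^N → ℝ` at `p`,
computed from the partial derivatives in the directions of the standard basis. -/
def gradSq {N : ℕ} (u : ℝ × EuclideanSpace ℝ (Fin N) → ℝ)
    (p : ℝ × EuclideanSpace ℝ (Fin N)) : ℝ :=
  (fderiv ℝ u p (1, 0)) ^ 2 +
    ∑ i : Fin N, (fderiv ℝ u p (0, EuclideanSpace.single i 1)) ^ 2

/-- Fundamental theorem of calculus in the first variable, integrated over the second one. -/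
theorem integral_boundary_eq_neg_setIntegral_fderiv {F : Type*} [NormedAddCommGroup F]
    [NormedSpace ℝ F] [FiniteDimensional ℝ F] [MeasurableSpace F] [BorelSpace F]
    (μ : Measure F) [SFinite μ] [IsFiniteMeasureOnCompacts μ] {v : ℝ × F → ℝ}
    (hv : ContDiff ℝ 1 v) (hc : HasCompactSupport v) :
    ∫ y, v (0, y) ∂μ =
      -∫ p in {p : ℝ × F | 0 < p.1}, fderiv ℝ v p (1, 0) ∂(volume.prod μ) := by
  have hset : {p : ℝ × F | 0 < p.1} = Ioi 0 ×ˢ univ := by ext; simp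
  have hint : Integrable (fun p => fderiv ℝ v p (1, 0)) (volume.prod μ) :=
    ((hv.continuous_fderiv one_ne_zero).clm_apply continuous_const).integrable_of_hasCompactSupport
      (hc.fderiv_apply (𝕜 := ℝ) _)
  have hmeas : (volume.prod μ).restrict (Ioi 0 ×ˢ univ) =
      (volume.restrict (Ioi (0 : ℝ))).prod μ := by
    rw [← Measure.prod_restrict, Measure.restrict_univ]
  have hint' := hint.restrict (s := Ioi (0 : ℝ) ×ˢ univ)
  rw [hset, hmeas] at *
  rw [integral_prod_symm _ hint', ← integral_neg]
  refine integral_congr_ae (.of_forall fun y => ?_)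
  have hd (x : ℝ) : HasDerivAt (fun x => v (x, y)) (fderiv ℝ v (x, y) (1, 0)) x :=
    (hv.differentiable one_ne_zero (x, y)).hasFDerivAt.comp_hasDerivAt x
      ((hasDerivAt_id x).prodMk (hasDerivAt_const x y))
  have hcy : HasCompactSupport fun x => v (x, y) :=
    hc.comp_isClosedEmbedding
      (Isometry.of_dist_eq fun a b => by simp [Prod.dist_eq]).isClosedEmbedding
  have hftc := hcy.integral_Ioi_deriv_eq
    (hv.comp (contDiff_id.prodMk contDiff_const)) 0
  have hderiv : deriv (fun x => v (x, y)) = fun x => fderiv ℝ v (x, y) (1, 0) :=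
    funext fun x => (hd x).deriv
  change ∫ x in Ioi 0, deriv (fun x => v (x, y)) x = _ at hftc
  rw [hderiv] at hftc
  simp [hftc]

/-- The Cauchy–Schwarz inequality for integrals of real functions. -/
theorem integral_mul_le_rpow_half_mul_rpow_half {α : Type*} [MeasurableSpace α] {μ : Measure α}
    {f g : α → ℝ} (hf : 0 ≤ f) (hg : 0 ≤ g) (hf2 : MemLp f 2 μ) (hg2 : MemLp g 2 μ) :
    ∫ a, f a * g a ∂μ ≤
      (∫ a, f a ^ 2 ∂μ) ^ ((1 : ℝ) / 2) * (∫ a, g a ^ 2 ∂μ) ^ ((1 : ℝ) / 2) := by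
  have h := integral_mul_le_Lp_mul_Lq_of_nonneg (μ := μ) HolderConjugate.two_two
    (.of_forall hf) (.of_forall hg) (by simpa using hf2) (by simpa using hg2)
  simpa using h

/-- Squared gradients of smooth compactly supported functions are integrable. -/
theorem integrable_gradSq {N : ℕ} {u : ℝ × EuclideanSpace ℝ (Fin N) → ℝ}
    (hu : ContDiff ℝ 1 u) (hsupp : HasCompactSupport u) : Integrable (gradSq u) := by
  have h (w) : Integrable fun p => (fderiv ℝ u p w) ^ 2 := by
    refine Continuous.integrable_of_hasCompactSupport
      (((hu.continuous_fderiv one_ne_zero).clm_apply continuous_const).pow 2) ?_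
    exact (hsupp.fderiv_apply (𝕜 := ℝ) w).comp_left (g := fun s : ℝ => s ^ 2) (by simp)
  exact (h _).add (integrable_finsetSum _ fun i _ => h _)

/-- For `N ≥ 2`, `t ∈ [2, 2N/(N-1)]` and any smooth compactly supported
`u : ℝ × ℝ^N → ℝ`,
`∫_{ℝ^N} |u(0,y)|^t dy ≤ t · (∬_{ℝ^{N+1}_+} |u|^{2(t-1)})^{1/2} · (∬_{ℝ^{N+1}_+} |∇u|²)^{1/2}`. -/
theorem statement0 (N : ℕ) (hN : 2 ≤ N) (t : ℝ) (ht2 : 2 ≤ t)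
    (ht : t ≤ 2 * N / (N - 1))
    (u : ℝ × EuclideanSpace ℝ (Fin N) → ℝ)
    (hu : ContDiff ℝ (⊤ : ℕ∞) u) (hsupp : HasCompactSupport u) :
    ∫ y : EuclideanSpace ℝ (Fin N), |u (0, y)| ^ t ≤
      t * (∫ p in halfSpace N, |u p| ^ (2 * (t - 1))) ^ ((1 : ℝ) / 2) *
        (∫ p in halfSpace N, gradSq u p) ^ ((1 : ℝ) / 2) := by
  have ht0 : 0 < t := by linarith
  have hu1 : ContDiff ℝ 1 u := hu.of_le (by exact_mod_cast le_top)
  have hcd : Continuous fun p => fderiv ℝ u p (1, 0) :=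
    (hu1.continuous_fderiv one_ne_zero).clm_apply continuous_const
  have hsd : HasCompactSupport fun p => fderiv ℝ u p (1, 0) := hsupp.fderiv_apply (𝕜 := ℝ) _
  have hderiv (p) : |fderiv ℝ (fun p => |u p| ^ t) p (1, 0)| =
      t * (|u p| ^ (t - 1) * |fderiv ℝ u p (1, 0)|) := by
    have h := (hasDerivAt_abs_rpow (u p) (p := t) (by linarith)).comp_hasFDerivAt p
      (hu1.differentiable one_ne_zero p).hasFDerivAt
    have hpow : |u p| ^ (t - 2) * |u p| = |u p| ^ (t - 1) := by
      rw [← rpow_add_one' (abs_nonneg _) (by linarith)]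
      ring_nf
    rw [show fderiv ℝ (fun p => |u p| ^ t) p = _ from h.fderiv]
    simp only [_root_.smul_apply, smul_eq_mul, abs_mul, abs_of_pos ht0,
      abs_of_nonneg (rpow_nonneg (abs_nonneg (u p)) (t - 2))]
    rw [← hpow]
    ring
  have hcp : Continuous fun p => |u p| ^ (t - 1) :=
    hu1.continuous.abs.rpow_const fun _ => Or.inr (by linarith)
  have hsp : HasCompactSupport fun p => |u p| ^ (t - 1) :=
    hsupp.comp_left (g := fun s : ℝ => |s| ^ (t - 1))
      (by simp [zero_rpow (show t - 1 ≠ 0 by linarith)])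
  have hv : ContDiff ℝ 1 fun p => |u p| ^ t :=
    (contDiff_norm_rpow (E := ℝ) (p := t) (by linarith)).comp hu1
  have hvc : HasCompactSupport fun p => |u p| ^ t :=
    hsupp.comp_left (g := fun s : ℝ => |s| ^ t) (by simp [zero_rpow ht0.ne'])
  have hcs := integral_mul_le_rpow_half_mul_rpow_half
    (μ := volume.restrict (halfSpace N)) (f := fun p => |u p| ^ (t - 1))
    (g := fun p => |fderiv ℝ u p (1, 0)|) (fun p => by positivity) (fun p => by positivity)
    ((hcp.memLp_of_hasCompactSupport hsp).restrict _)
    ((hcd.abs.memLp_of_hasCompactSupport (hsd.comp_left (g := fun s : ℝ => |s|) (by simp))).restrict _)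
  have hsq (p) : (|u p| ^ (t - 1)) ^ 2 = |u p| ^ (2 * (t - 1)) := by
    rw [mul_comm, rpow_mul (abs_nonneg _), rpow_two]
  simp only [hsq, sq_abs] at hcs
  have hgrad : ∫ p in halfSpace N, (fderiv ℝ u p (1, 0)) ^ 2 ≤ ∫ p in halfSpace N, gradSq u p :=
    integral_mono_of_nonneg (.of_forall fun p => sq_nonneg _)
      (integrable_gradSq hu1 hsupp).integrableOn
      (.of_forall fun p => le_add_of_nonneg_right (Finset.sum_nonneg fun i _ => sq_nonneg _))
  calc ∫ y : EuclideanSpace ℝ (Fin N), |u (0, y)| ^ t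
      = -∫ p in halfSpace N, fderiv ℝ (fun p => |u p| ^ t) p (1, 0) :=
        integral_boundary_eq_neg_setIntegral_fderiv volume hv hvc
    _ ≤ ∫ p in halfSpace N, |fderiv ℝ (fun p => |u p| ^ t) p (1, 0)| :=
        (neg_le_abs _).trans abs_integral_le_integral_abs
    _ = t * ∫ p in halfSpace N, |u p| ^ (t - 1) * |fderiv ℝ u p (1, 0)| := by
        simp only [hderiv, integral_const_mul]
    _ ≤ t * ((∫ p in halfSpace N, |u p| ^ (2 * (t - 1))) ^ ((1 : ℝ) / 2) *
          (∫ p in halfSpace N, (fderiv ℝ u p (1, 0)) ^ 2) ^ ((1 : ℝ) / 2)) := by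
        gcongr
    _ ≤ t * ((∫ p in halfSpace N, |u p| ^ (2 * (t - 1))) ^ ((1 : ℝ) / 2) *
          (∫ p in halfSpace N, gradSq u p) ^ ((1 : ℝ) / 2)) := by
        gcongr
    _ = _ := (mul_assoc _ _ _).symm

end
end

section
/- Let N ≥ 2 and let t ∈ [2, 2N/(N−1)]. Then for every smooth compactly supported function u : ℝ × ℝ^N → ℝ one has (∫_{ℝ^N} |u(0,y)|^t dy)^{1/t} ≤ ((t−1)/t) · (∬_{ℝ^{N+1}_+} |u|^{2(t−1)} dx dy)^{1/(2(t−1))} + (∬_{ℝ^{N+1}_+} |∇u|² dx dy)^{1/2}. -/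
open MeasureTheory Real Filter Set

noncomputable section

theorem HasCompactSupport.comp_prodMk_right {E : Type*} [TopologicalSpace E]
    {u : ℝ × E → ℝ} (hsupp : HasCompactSupport u) (y : E) :
    HasCompactSupport fun x : ℝ => u (x, y) := by
  refine HasCompactSupport.of_support_subset_isCompact
    (hsupp.isCompact.image continuous_fst) fun x hx => ?_
  exact ⟨(x, y), subset_tsupport u hx, rfl⟩

theorem volume_restrict_Ioi_prod {E : Type*} [MeasureSpace E] [SFinite (volume : Measure E)] :
    (volume : Measure (ℝ × E)).restrict {p | 0 < p.1} =
      (volume.restrict (Ioi (0 : ℝ))).prod volume := by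
  have hset : {p : ℝ × E | 0 < p.1} = Ioi 0 ×ˢ univ := by ext; simp
  rw [hset, Measure.volume_eq_prod, ← Measure.prod_restrict, Measure.restrict_univ]

section Trace

variable {E : Type*} [NormedAddCommGroup E] [NormedSpace ℝ E] {u : ℝ × E → ℝ} {t : ℝ}

theorem abs_rpow_trace_le (hu : ContDiff ℝ 1 u) (hsupp : HasCompactSupport u) (ht : 1 < t)
    (y : E) :
    |u (0, y)| ^ t ≤
      ∫ x in Ioi (0 : ℝ), t * (|u (x, y)| ^ (t - 1) * |fderiv ℝ u (x, y) (1, 0)|) := by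
  have hslice : ContDiff ℝ 1 fun x : ℝ => u (x, y) := by fun_prop
  have hsliceSupp := hsupp.comp_prodMk_right y
  have hderiv (x : ℝ) : HasDerivAt (fun x : ℝ => |u (x, y)| ^ t)
      (t * |u (x, y)| ^ (t - 2) * u (x, y) * fderiv ℝ u (x, y) (1, 0)) x := by
    have hline : HasDerivAt (fun x : ℝ => (x, y)) ((1 : ℝ), (0 : E)) x :=
      (hasDerivAt_id x).prodMk (hasDerivAt_const x y)
    exact (hasDerivAt_abs_rpow (u (x, y)) ht).comp x
      ((hu.differentiable one_ne_zero (x, y)).hasFDerivAt.comp_hasDerivAt x hline)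
  have hpowSupp : HasCompactSupport fun x : ℝ => |u (x, y)| ^ t :=
    hsliceSupp.comp_left (g := fun z : ℝ => |z| ^ t) (by simp [(by linarith : t ≠ 0)])
  have hpow : ContDiff ℝ 1 fun x : ℝ => |u (x, y)| ^ t := hslice.norm_rpow ht
  have hFTC := hpowSupp.integral_Ioi_deriv_eq hpow 0
  calc
    |u (0, y)| ^ t = ‖∫ x in Ioi (0 : ℝ), deriv (fun x : ℝ => |u (x, y)| ^ t) x‖ := by
      rw [hFTC, norm_neg, Real.norm_of_nonneg (by positivity)]
    _ ≤ ∫ x in Ioi (0 : ℝ), ‖deriv (fun x : ℝ => |u (x, y)| ^ t) x‖ :=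
      norm_integral_le_integral_norm _
    _ = _ := by
      congr 1 with x
      rw [(hderiv x).deriv]
      rcases eq_or_ne (u (x, y)) 0 with h | h
      · simp [h, Real.zero_rpow (by linarith : t - 1 ≠ 0)]
      · rw [show t - 1 = t - 2 + 1 by ring, Real.rpow_add_one (abs_ne_zero.mpr h)]
        simp only [norm_mul, Real.norm_eq_abs, abs_of_pos (by linarith : 0 < t),
          abs_of_nonneg (Real.rpow_nonneg (abs_nonneg (u (x, y))) (t - 2))]
        ring

theorem integral_abs_rpow_trace_le [FiniteDimensional ℝ E] [MeasureSpace E] [BorelSpace E]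
    [IsLocallyFiniteMeasure (volume : Measure E)] [SFinite (volume : Measure E)]
    (hu : ContDiff ℝ 1 u) (hsupp : HasCompactSupport u) (ht : 1 < t) :
    ∫ y : E, |u (0, y)| ^ t ≤
      t * ((∫ p in {p : ℝ × E | 0 < p.1}, |u p| ^ (2 * (t - 1))) ^ ((1 : ℝ) / 2) *
        (∫ p in {p : ℝ × E | 0 < p.1}, (fderiv ℝ u p (1, 0)) ^ 2) ^ ((1 : ℝ) / 2)) := by
  have ht0 : 0 < t - 1 := sub_pos.mpr ht
  have hF : Continuous fun p => |u p| ^ (t - 1) :=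
    hu.continuous.abs.rpow_const fun _ => Or.inr ht0.le
  have hFsupp : HasCompactSupport fun p => |u p| ^ (t - 1) :=
    hsupp.comp_left (g := fun z : ℝ => |z| ^ (t - 1)) (by simp [ht0.ne'])
  have hG : Continuous fun p => |fderiv ℝ u p (1, 0)| :=
    ((hu.continuous_fderiv one_ne_zero).clm_apply continuous_const).abs
  have hGsupp : HasCompactSupport fun p => |fderiv ℝ u p (1, 0)| :=
    (hsupp.fderiv_apply ℝ (1, 0)).comp_left abs_zero
  have hint : Integrable (fun p => t * (|u p| ^ (t - 1) * |fderiv ℝ u p (1, 0)|))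
      ((volume.restrict (Ioi (0 : ℝ))).prod volume) := by
    rw [← volume_restrict_Ioi_prod]
    exact (((hF.mul hG).integrable_of_hasCompactSupport hFsupp.mul_right).const_mul t).restrict
  have hHolder := integral_mul_le_Lp_mul_Lq_of_nonneg
    (μ := (volume : Measure (ℝ × E)).restrict {p | 0 < p.1}) Real.HolderConjugate.two_two
    (Eventually.of_forall fun p => Real.rpow_nonneg (abs_nonneg (u p)) (t - 1))
    (Eventually.of_forall fun p => abs_nonneg (fderiv ℝ u p (1, 0)))
    (hF.memLp_of_hasCompactSupport hFsupp) (hG.memLp_of_hasCompactSupport hGsupp)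
  calc
    ∫ y : E, |u (0, y)| ^ t ≤
        ∫ y : E, ∫ x in Ioi (0 : ℝ), t * (|u (x, y)| ^ (t - 1) * |fderiv ℝ u (x, y) (1, 0)|) :=
      integral_mono_of_nonneg (Eventually.of_forall fun y => by positivity)
        hint.integral_prod_right (Eventually.of_forall fun y => abs_rpow_trace_le hu hsupp ht y)
    _ = t * ∫ p in {p : ℝ × E | 0 < p.1}, |u p| ^ (t - 1) * |fderiv ℝ u p (1, 0)| := by
      rw [← integral_prod_symm _ hint, volume_restrict_Ioi_prod, integral_const_mul]
    _ ≤ _ := by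
      refine mul_le_mul_of_nonneg_left (hHolder.trans_eq ?_) (by linarith)
      simp only [← Real.rpow_mul (abs_nonneg _), Real.rpow_two, sq_abs, mul_comm (t - 1)]

end Trace

theorem rpow_le_add_of_le_mul {t A B I : ℝ} (ht : 1 < t) (hA : 0 ≤ A) (hB : 0 ≤ B) (hI : 0 ≤ I)
    (h : I ≤ t * (A ^ (t - 1) * B)) :
    I ^ (1 / t) ≤ (t - 1) / t * A + B := by
  have ht0 : 0 < t := by linarith
  calc
    I ^ (1 / t) ≤ (t * (A ^ (t - 1) * B)) ^ (1 / t) := by gcongr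
    _ = A ^ ((t - 1) / t) * (t * B) ^ (1 / t) := by
      rw [mul_left_comm, Real.mul_rpow (by positivity) (by positivity), ← Real.rpow_mul hA,
        mul_one_div]
    _ ≤ (t - 1) / t * A + 1 / t * (t * B) :=
      Real.geom_mean_le_arith_mean2_weighted (div_nonneg (by linarith) ht0.le) (by positivity) hA
        (by positivity) (by field_simp; ring)
    _ = (t - 1) / t * A + B := by field_simp

/-- For `N ≥ 2`, `t ∈ [2, 2N/(N-1)]` and any smooth compactly supported
`u : ℝ × ℝ^N → ℝ`,
`(∫_{ℝ^N} |u(0,y)|^t dy)^{1/t} ≤ ((t-1)/t) (∬ |u|^{2(t-1)})^{1/(2(t-1))} + (∬ |∇u|²)^{1/2}`. -/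
theorem statement1 (N : ℕ) (hN : 2 ≤ N) (t : ℝ) (ht2 : 2 ≤ t)
    (ht : t ≤ 2 * N / (N - 1))
    (u : ℝ × EuclideanSpace ℝ (Fin N) → ℝ)
    (hu : ContDiff ℝ (⊤ : ℕ∞) u) (hsupp : HasCompactSupport u) :
    (∫ y : EuclideanSpace ℝ (Fin N), |u (0, y)| ^ t) ^ ((1 : ℝ) / t) ≤
      ((t - 1) / t) *
          (∫ p in halfSpace N, |u p| ^ (2 * (t - 1))) ^ (1 / (2 * (t - 1))) +
        (∫ p in halfSpace N, gradSq u p) ^ ((1 : ℝ) / 2) := by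
  have ht1 : 1 < t := by linarith
  have hu1 : ContDiff ℝ 1 u := hu.of_le (mod_cast le_top)
  have hA : 0 ≤ ∫ p in halfSpace N, |u p| ^ (2 * (t - 1)) :=
    integral_nonneg fun p => by positivity
  have hgrad : ∫ p in halfSpace N, (fderiv ℝ u p (1, 0)) ^ 2 ≤ ∫ p in halfSpace N, gradSq u p :=
    integral_mono_of_nonneg (Eventually.of_forall fun p => sq_nonneg _)
      (integrable_gradSq hu1 hsupp).restrict
      (Eventually.of_forall fun p => le_add_of_nonneg_right (by positivity))
  have hgrad0 : 0 ≤ ∫ p in halfSpace N, (fderiv ℝ u p (1, 0)) ^ 2 :=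
    integral_nonneg fun p => sq_nonneg _
  have hexp : 1 / (2 * (t - 1)) * (t - 1) = 1 / 2 := by
    have : t - 1 ≠ 0 := by linarith
    field_simp
  refine rpow_le_add_of_le_mul ht1 (by positivity) (Real.rpow_nonneg (hgrad0.trans hgrad) _)
    (integral_nonneg fun y => by positivity)
    ((integral_abs_rpow_trace_le hu1 hsupp ht1).trans ?_)
  rw [← Real.rpow_mul hA, hexp]
  change t * ((∫ p in halfSpace N, _) ^ _ * (∫ p in halfSpace N, _) ^ _) ≤ _
  gcongr

end
end

section
/- Let f : ℝ → ℝ be continuous with f(t) = 0 for t ≤ 0, and suppose t ↦ f(t)/t is monotone increasing on (0,∞). Then f satisfies the Ambrosetti–Rabinowitz inequality 2F(t) ≤ t·f(t) for all t > 0, where F(t) = ∫₀^t f(s) ds. -/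
open MeasureTheory Real Filter Set

/-- If `f : ℝ → ℝ` is continuous, vanishes on `(-∞,0]`, and `t ↦ f(t)/t`
is monotone increasing on `(0,∞)`, then `f` satisfies the Ambrosetti–Rabinowitz inequality
`2F(t) ≤ t·f(t)` for all `t > 0`, where `F(t) = ∫₀^t f(s) ds`. -/
theorem statement3 (f : ℝ → ℝ) (hf : Continuous f)
    (hf0 : ∀ t ≤ (0 : ℝ), f t = 0)
    (hmono : MonotoneOn (fun t => f t / t) (Set.Ioi (0 : ℝ))) :
    ∀ t : ℝ, 0 < t → 2 * (∫ s in (0 : ℝ)..t, f s) ≤ t * f t := by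
  intro t ht
  have hle : ∀ s ∈ Set.Icc (0 : ℝ) t, f s ≤ f t / t * s := by
    rintro s ⟨hs0, hst⟩
    rcases hs0.eq_or_lt with rfl | hs
    · simp [hf0 0 le_rfl]
    · exact (div_le_iff₀ hs).mp (hmono hs ht hst)
  have hint : (∫ s in (0 : ℝ)..t, f s) ≤ ∫ s in (0 : ℝ)..t, f t / t * s :=
    intervalIntegral.integral_mono_on ht.le (hf.intervalIntegrable _ _)
      ((continuous_const.mul continuous_id).intervalIntegrable _ _) hle
  rw [intervalIntegral.integral_const_mul, integral_id] at hint
  calc 2 * (∫ s in (0 : ℝ)..t, f s) ≤ 2 * (f t / t * ((t ^ 2 - 0 ^ 2) / 2)) := by gcongr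
    _ = t * f t := by field_simp; ring
end

section
/- Let N ≥ 1, m > 0 and α ∈ (0,m). Define f : ℝ × ℝ^N → ℝ by f(x,y) = e^{−αx} e^{−(m−α)√(x²+|y|²)}. Then at every point (x,y) with x > 0 the function f is smooth and its Laplacian satisfies Δf(x,y) = (α² + (m−α)² + 2α(m−α)x/ρ − N(m−α)/ρ) f(x,y), where ρ = √(x²+|y|²); consequently −Δf(x,y) + m² f(x,y) ≥ 0 for every (x,y) with x > 0. -/
open MeasureTheory Real Filter Set

noncomputable section

/-- Second directional derivative of `f` at `p` in direction `v`. -/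
def secondD {N : ℕ} (f : ℝ × EuclideanSpace ℝ (Fin N) → ℝ)
    (p v : ℝ × EuclideanSpace ℝ (Fin N)) : ℝ :=
  fderiv ℝ (fun q => fderiv ℝ f q v) p v

/-- The Laplacian in all `N+1` variables `(x,y) ∈ ℝ × ℝ^N`:
`Δf = ∂²f/∂x² + Σᵢ ∂²f/∂yᵢ²`. -/
def lapl {N : ℕ} (f : ℝ × EuclideanSpace ℝ (Fin N) → ℝ)
    (p : ℝ × EuclideanSpace ℝ (Fin N)) : ℝ :=
  secondD f p (1, 0) + ∑ i : Fin N, secondD f p (0, EuclideanSpace.single i 1)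

/-- The barrier function `f(x,y) = e^{−αx} e^{−(m−α)√(x²+|y|²)}`. -/
def barrier {N : ℕ} (m α : ℝ) (p : ℝ × EuclideanSpace ℝ (Fin N)) : ℝ :=
  Real.exp (-α * p.1) * Real.exp (-(m - α) * Real.sqrt (p.1 ^ 2 + ‖p.2‖ ^ 2))

section SecondDerivative

variable {N : ℕ} {m α : ℝ} {p : ℝ × EuclideanSpace ℝ (Fin N)}

/-- The distance `√(x² + |y|²)` to the origin. -/
def radius (p : ℝ × EuclideanSpace ℝ (Fin N)) : ℝ :=
  Real.sqrt (p.1 ^ 2 + ‖p.2‖ ^ 2)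

/-- The Euclidean inner product of `p` and `v` in `ℝ × ℝ^N`, as a linear form in `v`. -/
def innerForm (p : ℝ × EuclideanSpace ℝ (Fin N)) : ℝ × EuclideanSpace ℝ (Fin N) →L[ℝ] ℝ :=
  p.1 • ContinuousLinearMap.fst ℝ ℝ (EuclideanSpace ℝ (Fin N)) +
    (innerSL ℝ p.2).comp (ContinuousLinearMap.snd ℝ ℝ (EuclideanSpace ℝ (Fin N)))

lemma innerForm_apply (p v : ℝ × EuclideanSpace ℝ (Fin N)) :
    innerForm p v = p.1 * v.1 + inner ℝ p.2 v.2 := by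
  simp [innerForm]

lemma innerForm_comm (p v : ℝ × EuclideanSpace ℝ (Fin N)) : innerForm p v = innerForm v p := by
  rw [innerForm_apply, innerForm_apply, real_inner_comm, mul_comm]

lemma radius_pos (hp : 0 < p.1) : 0 < radius p :=
  Real.sqrt_pos.2 (by positivity)

lemma hasFDerivAt_radius (hp : 0 < p.1) :
    HasFDerivAt radius ((radius p)⁻¹ • innerForm p) p := by
  have h1 : HasFDerivAt (fun q : ℝ × EuclideanSpace ℝ (Fin N) => q.1 ^ 2 + ‖q.2‖ ^ 2)
      ((2 : ℝ) • innerForm p) p := by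
    refine ((hasFDerivAt_fst.pow 2).add hasFDerivAt_snd.norm_sq).congr_fderiv ?_
    ext v <;> simp [innerForm]
  refine (h1.sqrt (by positivity)).congr_fderiv ?_
  have hr := radius_pos hp
  rw [smul_smul]
  congr 1
  change 1 / (2 * radius p) * 2 = _
  field_simp

lemma hasFDerivAt_barrier (hp : 0 < p.1) :
    HasFDerivAt (barrier (N := N) m α)
      (barrier m α p • ((-α) • ContinuousLinearMap.fst ℝ ℝ (EuclideanSpace ℝ (Fin N)) +
        (-(m - α)) • (radius p)⁻¹ • innerForm p)) p := by
  have h1 : HasFDerivAt (fun q : ℝ × EuclideanSpace ℝ (Fin N) => -α * q.1)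
      ((-α) • ContinuousLinearMap.fst ℝ ℝ (EuclideanSpace ℝ (Fin N))) p :=
    hasFDerivAt_fst.const_mul _
  have h2 := (hasFDerivAt_radius hp).const_mul (-(m - α))
  refine (h1.exp.mul h2.exp).congr_fderiv ?_
  ext v <;> simp [barrier, radius] <;> ring

lemma secondD_barrier (hp : 0 < p.1) (v : ℝ × EuclideanSpace ℝ (Fin N)) :
    secondD (barrier (N := N) m α) p v =
      barrier m α p * ((α * v.1 + (m - α) * innerForm p v / radius p) ^ 2 -
        (m - α) * (innerForm v v / radius p - innerForm p v ^ 2 / radius p ^ 3)) := by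
  have hr := radius_pos hp
  have hev : (fun q => fderiv ℝ (barrier (N := N) m α) q v) =ᶠ[nhds p]
      fun q => barrier m α q * (-α * v.1 + -(m - α) * ((radius q)⁻¹ * innerForm v q)) := by
    filter_upwards [continuous_fst.continuousAt.eventually (lt_mem_nhds hp)] with q hq
    rw [(hasFDerivAt_barrier hq).fderiv, innerForm_comm v q]
    simp
    ring
  have hinv := (hasDerivAt_inv hr.ne').comp_hasFDerivAt p (hasFDerivAt_radius hp)
  have hd := (hasFDerivAt_barrier (m := m) (α := α) hp).mul
    (((hinv.mul (innerForm v).hasFDerivAt).const_mul (-(m - α))).const_add (-α * v.1))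
  rw [secondD, hev.fderiv_eq]
  refine (congrArg (fun L => L v) hd.fderiv).trans ?_
  simp only [innerForm_comm v p, Pi.mul_apply, Function.comp_apply, add_apply,
    smul_apply, smul_eq_mul, ContinuousLinearMap.coe_fst']
  field_simp
  ring

lemma contDiffAt_barrier (hp : 0 < p.1) :
    ContDiffAt ℝ (⊤ : ℕ∞) (barrier (N := N) m α) p := by
  have h1 : ContDiffAt ℝ (⊤ : ℕ∞)
      (fun q : ℝ × EuclideanSpace ℝ (Fin N) => q.1 ^ 2 + ‖q.2‖ ^ 2) p :=
    (contDiffAt_fst.pow 2).add (contDiffAt_snd.norm_sq ℝ)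
  exact (contDiffAt_const.mul contDiffAt_fst).exp.mul
    (contDiffAt_const.mul (h1.sqrt (by positivity))).exp

lemma lapl_barrier (hp : 0 < p.1) :
    lapl (barrier (N := N) m α) p =
      (α ^ 2 + (m - α) ^ 2 + 2 * α * (m - α) * p.1 / radius p - N * (m - α) / radius p) *
        barrier m α p := by
  have hr := radius_pos hp
  have hsq : radius p ^ 2 = p.1 ^ 2 + ∑ i, p.2 i ^ 2 := by
    rw [radius, Real.sq_sqrt (by positivity), EuclideanSpace.real_norm_sq_eq]
  have hy (i : Fin N) : secondD (barrier (N := N) m α) p (0, EuclideanSpace.single i 1) =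
      barrier m α p * ((m - α) ^ 2 / radius p ^ 2 + (m - α) / radius p ^ 3) * p.2 i ^ 2 -
        barrier m α p * (m - α) / radius p := by
    rw [secondD_barrier hp]
    simp [innerForm_apply, EuclideanSpace.inner_single_right]
    field_simp
    ring
  have hx : secondD (barrier (N := N) m α) p (1, 0) =
      barrier m α p * ((α + (m - α) * p.1 / radius p) ^ 2 -
        (m - α) * (1 / radius p - p.1 ^ 2 / radius p ^ 3)) := by
    rw [secondD_barrier hp]
    simp [innerForm_apply]
  have hs : ∑ i, p.2 i ^ 2 = radius p ^ 2 - p.1 ^ 2 := by rw [hsq]; ring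
  simp only [lapl, hx, hy, Finset.sum_sub_distrib, ← Finset.mul_sum, hs, Finset.sum_const,
    Finset.card_univ, Fintype.card_fin, nsmul_eq_mul]
  field_simp
  ring

end SecondDerivative

/-- For `N ≥ 1`, `m > 0`, `α ∈ (0,m)` and
`f(x,y) = e^{−αx} e^{−(m−α)√(x²+|y|²)}`: at every point with `x > 0`, `f` is smooth,
`Δf = (α² + (m−α)² + 2α(m−α)x/ρ − N(m−α)/ρ) f` with `ρ = √(x²+|y|²)`, and consequently
`−Δf + m²f ≥ 0`. -/
theorem statement17 (N : ℕ) (hN : 1 ≤ N) (m α : ℝ) (hm : 0 < m)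
    (hα0 : 0 < α) (hαm : α < m) :
    ∀ (x : ℝ), 0 < x → ∀ y : EuclideanSpace ℝ (Fin N),
      ContDiffAt ℝ (⊤ : ℕ∞) (barrier (N := N) m α) (x, y) ∧
      lapl (barrier (N := N) m α) (x, y) =
        (α ^ 2 + (m - α) ^ 2 +
            2 * α * (m - α) * x / Real.sqrt (x ^ 2 + ‖y‖ ^ 2) -
            N * (m - α) / Real.sqrt (x ^ 2 + ‖y‖ ^ 2)) * barrier m α (x, y) ∧
      0 ≤ -lapl (barrier (N := N) m α) (x, y) + m ^ 2 * barrier m α (x, y) := by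
  intro x hx y
  have hl := lapl_barrier (m := m) (α := α) (p := (x, y)) hx
  refine ⟨contDiffAt_barrier hx, hl, ?_⟩
  have hr : 0 < radius (x, y) := radius_pos hx
  have hxr : x / radius (x, y) ≤ 1 :=
    (div_le_one hr).2 (Real.le_sqrt_of_sq_le (by simp))
  have hb : 0 < barrier m α (x, y) := by unfold barrier; positivity
  have hβ : 0 < m - α := sub_pos.2 hαm
  have hN' : 0 ≤ N * (m - α) / radius (x, y) := by positivity
  have hc : 2 * α * (m - α) * x / radius (x, y) ≤ 2 * α * (m - α) := by
    rw [mul_div_assoc]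
    exact mul_le_of_le_one_right (by positivity) hxr
  rw [hl]
  have : 0 ≤ (m ^ 2 - (α ^ 2 + (m - α) ^ 2 + 2 * α * (m - α) * x / radius (x, y) -
      N * (m - α) / radius (x, y))) * barrier m α (x, y) :=
    mul_nonneg (by linarith [hc, hN', show m ^ 2 = α ^ 2 + (m - α) ^ 2 + 2 * α * (m - α) by ring])
      hb.le
  linarith

end
end
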